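/- arXiv:1110.4379 — 5 statements merged into one kernel-verified Lean document; each statement's English description precedes it below -/
import Mathlib

section
/- For every integer n ≥ 1, the number of permutations π of {1, 2, …, n} that contain the pattern 321 exactly once (i.e., there is exactly one triple of indices i < j < k with π(i) > π(j) > π(k)) equals (3/n)·C(2n, n+3), where C(2n, n+3) denotes the binomial coefficient '2n choose n+3'. -/
/-- A permutation `π` of `Fin n` (representing `{1, …, n}`) has an occurrence of the
pattern 321 at the triple of indices `(t.1, t.2.1, t.2.2)` if the indices are increasing
and the corresponding values are strictly decreasing. -/
def Occ321 {n : ℕ} (π : Equiv.Perm (Fin n)) (t : Fin n × Fin n × Fin n) : Prop :=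
  t.1 < t.2.1 ∧ t.2.1 < t.2.2 ∧ π t.2.1 < π t.1 ∧ π t.2.2 < π t.2.1

/-- `π` contains the pattern 321 exactly once. -/
def ExactlyOne321 {n : ℕ} (π : Equiv.Perm (Fin n)) : Prop :=
  ∃! t : Fin n × Fin n × Fin n, Occ321 π t

/-- The number of permutations of `Fin n` satisfying `P`. -/
noncomputable def permCount {n : ℕ} (P : Equiv.Perm (Fin n) → Prop) : ℕ :=
  Nat.card {σ : Equiv.Perm (Fin n) // P σ}

lemma permCount_congr {n : ℕ} {P Q : Equiv.Perm (Fin n) → Prop} (h : ∀ σ, P σ ↔ Q σ) :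
    permCount P = permCount Q :=
  Nat.card_congr (Equiv.subtypeEquivRight h)

lemma permCount_eq_zero {n : ℕ} {P : Equiv.Perm (Fin n) → Prop} (h : ∀ σ, ¬ P σ) :
    permCount P = 0 := by
  have : IsEmpty {σ : Equiv.Perm (Fin n) // P σ} := ⟨fun x => h x.1 x.2⟩
  exact Nat.card_of_isEmpty

lemma permCount_or {n : ℕ} {P Q : Equiv.Perm (Fin n) → Prop} (h : ∀ σ, P σ → ¬ Q σ) :
    permCount (fun σ => P σ ∨ Q σ) = permCount P + permCount Q := by
  classical
  unfold permCount
  have hd : Disjoint P Q := by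
    rw [Pi.disjoint_iff]
    intro σ
    rw [Prop.disjoint_iff]
    exact fun hp => h σ hp.1 hp.2
  rw [← Nat.card_sum]
  exact Nat.card_congr (subtypeOrEquiv P Q hd)

/-- The permutation whose one-line notation starts with `v` and continues with `σ`,
relabelled so as to avoid `v`. -/
def permCons {n : ℕ} (v : Fin (n + 1)) (σ : Equiv.Perm (Fin n)) : Equiv.Perm (Fin (n + 1)) :=
  (finSuccEquiv' 0).trans ((Equiv.optionCongr σ).trans (finSuccEquiv' v).symm)

@[simp] lemma permCons_zero {n : ℕ} (v : Fin (n + 1)) (σ : Equiv.Perm (Fin n)) :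
    permCons v σ 0 = v := by
  simp [permCons]

@[simp] lemma permCons_succ {n : ℕ} (v : Fin (n + 1)) (σ : Equiv.Perm (Fin n)) (i : Fin n) :
    permCons v σ i.succ = v.succAbove (σ i) := by
  have : finSuccEquiv' (0 : Fin (n + 1)) i.succ = some i := by
    rw [← Fin.succAbove_zero_apply, finSuccEquiv'_succAbove]
  simp [permCons, this]

lemma permCons_bijective (n : ℕ) :
    Function.Bijective (fun x : Fin (n + 1) × Equiv.Perm (Fin n) => permCons x.1 x.2) := by
  rw [Fintype.bijective_iff_injective_and_card]
  constructor
  · rintro ⟨v, σ⟩ ⟨w, τ⟩ h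
    have hv : v = w := by simpa using congrArg (fun π => π 0) h
    subst hv
    have : σ = τ := by
      ext1 i
      simpa using congrArg (fun π => π i.succ) h
    rw [this]
  · simp [Fintype.card_perm, Nat.factorial_succ]

lemma permCount_succ {n : ℕ} (P : Equiv.Perm (Fin (n + 1)) → Prop) :
    permCount P = ∑ v : Fin (n + 1), permCount (fun σ => P (permCons v σ)) := by
  unfold permCount
  rw [← Nat.card_sigma]
  refine Nat.card_congr (Equiv.trans ?_
    (Equiv.subtypeProdEquivSigmaSubtype (fun v σ => P (permCons v σ))))
  exact ((Equiv.ofBijective _ (permCons_bijective n)).subtypeEquiv (fun _ => Iff.rfl)).symm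

/-- If the solutions of `Q` lie in the disjoint ranges of two injections, then `Q` has a unique
solution iff it has a unique solution along one of them and none along the other. -/
lemma existsUnique_iff_of_ranges {α β γ : Type*} {Q : α → Prop} (f : β → α) (g : γ → α)
    (hf : Function.Injective f) (hg : Function.Injective g) (hfg : ∀ b c, f b ≠ g c)
    (hQ : ∀ a, Q a → (∃ b, f b = a) ∨ ∃ c, g c = a) :
    (∃! a, Q a) ↔ ((∃! b, Q (f b)) ∧ ∀ c, ¬ Q (g c)) ∨ ((∀ b, ¬ Q (f b)) ∧ ∃! c, Q (g c)) := by
  constructor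
  · rintro ⟨a, ha, hu⟩
    rcases hQ a ha with ⟨b, rfl⟩ | ⟨c, rfl⟩
    · exact Or.inl ⟨⟨b, ha, fun b' hb' => hf (hu _ hb')⟩, fun c hc => hfg _ _ (hu _ hc).symm⟩
    · exact Or.inr ⟨fun b hb => hfg _ _ (hu _ hb), ⟨c, ha, fun c' hc' => hg (hu _ hc')⟩⟩
  · rintro (⟨⟨b, hb, hu⟩, hn⟩ | ⟨hn, ⟨c, hc, hu⟩⟩)
    · refine ⟨f b, hb, fun a ha => ?_⟩
      rcases hQ a ha with ⟨b', rfl⟩ | ⟨c, rfl⟩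
      · rw [hu b' ha]
      · exact absurd ha (hn c)
    · refine ⟨g c, hc, fun a ha => ?_⟩
      rcases hQ a ha with ⟨b, rfl⟩ | ⟨c', rfl⟩
      · exact absurd ha (hn b)
      · rw [hu c' ha]

/-- `σ` avoids the pattern 321. -/
def Avoids321 {n : ℕ} (σ : Equiv.Perm (Fin n)) : Prop := ∀ t, ¬ Occ321 σ t

/-- `p` is an inversion of `σ` whose larger value is less than `v`. -/
def InvBelow {n : ℕ} (σ : Equiv.Perm (Fin n)) (v : ℕ) (p : Fin n × Fin n) : Prop :=
  p.1 < p.2 ∧ σ p.2 < σ p.1 ∧ (σ p.1 : ℕ) < v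

/-- No inversion of `σ` has its larger value less than `v`. -/
def NoInvBelow {n : ℕ} (σ : Equiv.Perm (Fin n)) (v : ℕ) : Prop := ∀ p, ¬ InvBelow σ v p

/-- Exactly one inversion of `σ` has its larger value less than `v`. -/
def OneInvBelow {n : ℕ} (σ : Equiv.Perm (Fin n)) (v : ℕ) : Prop := ∃! p, InvBelow σ v p

lemma noInvBelow_of_le_one {n : ℕ} (σ : Equiv.Perm (Fin n)) {v : ℕ} (hv : v ≤ 1) :
    NoInvBelow σ v := by
  rintro ⟨i, j⟩ ⟨-, h, h'⟩
  simp only [Fin.lt_def] at h h'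
  omega

lemma NoInvBelow.mono {n : ℕ} {σ : Equiv.Perm (Fin n)} {v w : ℕ} (h : NoInvBelow σ w)
    (hvw : v ≤ w) : NoInvBelow σ v :=
  fun p hp => h p ⟨hp.1, hp.2.1, hp.2.2.trans_le hvw⟩

lemma OneInvBelow.not_noInvBelow {n : ℕ} {σ : Equiv.Perm (Fin n)} {v : ℕ}
    (h : OneInvBelow σ v) : ¬ NoInvBelow σ v :=
  fun h' => h' _ h.choose_spec.1

lemma val_succAbove {n : ℕ} (v : Fin (n + 1)) (x : Fin n) :
    (v.succAbove x : ℕ) = if (x : ℕ) < v then (x : ℕ) else x + 1 := by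
  by_cases h : (x : ℕ) < v
  · rw [Fin.succAbove_of_castSucc_lt _ _ (by simpa [Fin.lt_def] using h)]
    simp [h]
  · rw [Fin.succAbove_of_le_castSucc _ _ (by simpa [Fin.le_def] using h)]
    simp [h]

lemma succAbove_lt_self_iff {n : ℕ} (v : Fin (n + 1)) (x : Fin n) :
    v.succAbove x < v ↔ (x : ℕ) < v := by
  rw [Fin.lt_def, val_succAbove]
  split_ifs with h <;> omega

lemma occ321_permCons_succ {n : ℕ} (v : Fin (n + 1)) (σ : Equiv.Perm (Fin n))
    (t : Fin n × Fin n × Fin n) :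
    Occ321 (permCons v σ) (t.1.succ, t.2.1.succ, t.2.2.succ) ↔ Occ321 σ t := by
  simp [Occ321]

lemma occ321_permCons_zero {n : ℕ} (v : Fin (n + 1)) (σ : Equiv.Perm (Fin n))
    (p : Fin n × Fin n) :
    Occ321 (permCons v σ) (0, p.1.succ, p.2.succ) ↔ InvBelow σ v p := by
  simp [Occ321, InvBelow, succAbove_lt_self_iff]
  tauto

lemma occ321_mem_ranges {n : ℕ} (π : Equiv.Perm (Fin (n + 1)))
    (t : Fin (n + 1) × Fin (n + 1) × Fin (n + 1)) (h : Occ321 π t) :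
    (∃ b : Fin n × Fin n × Fin n, (b.1.succ, b.2.1.succ, b.2.2.succ) = t) ∨
      ∃ c : Fin n × Fin n, (0, c.1.succ, c.2.succ) = t := by
  obtain ⟨i, j, k⟩ := t
  obtain ⟨h1, h2, -⟩ := h
  dsimp only at h1 h2
  obtain ⟨j, rfl⟩ := Fin.exists_succ_eq.2 (Fin.ne_zero_of_lt h1)
  obtain ⟨k, rfl⟩ := Fin.exists_succ_eq.2 (Fin.ne_zero_of_lt h2)
  rcases Fin.eq_zero_or_eq_succ i with rfl | ⟨i, rfl⟩
  · exact Or.inr ⟨(j, k), rfl⟩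
  · exact Or.inl ⟨(i, j, k), rfl⟩

lemma avoids321_permCons {n : ℕ} (v : Fin (n + 1)) (σ : Equiv.Perm (Fin n)) :
    Avoids321 (permCons v σ) ↔ Avoids321 σ ∧ NoInvBelow σ v := by
  constructor
  · intro h
    exact ⟨fun t ht => h _ ((occ321_permCons_succ v σ t).2 ht),
      fun p hp => h _ ((occ321_permCons_zero v σ p).2 hp)⟩
  · rintro ⟨h1, h2⟩ t ht
    rcases occ321_mem_ranges _ t ht with ⟨b, rfl⟩ | ⟨c, rfl⟩
    · exact h1 _ ((occ321_permCons_succ v σ b).1 ht)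
    · exact h2 _ ((occ321_permCons_zero v σ c).1 ht)

lemma exactlyOne321_permCons {n : ℕ} (v : Fin (n + 1)) (σ : Equiv.Perm (Fin n)) :
    ExactlyOne321 (permCons v σ) ↔
      (ExactlyOne321 σ ∧ NoInvBelow σ v) ∨ (Avoids321 σ ∧ OneInvBelow σ v) := by
  unfold ExactlyOne321
  rw [existsUnique_iff_of_ranges
    (fun b : Fin n × Fin n × Fin n => (b.1.succ, b.2.1.succ, b.2.2.succ))
    (fun c : Fin n × Fin n => ((0 : Fin (n + 1)), c.1.succ, c.2.succ))
    ?_ ?_ ?_ (occ321_mem_ranges _)]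
  · simp only [occ321_permCons_succ, occ321_permCons_zero]
    rfl
  · rintro ⟨a, b, c⟩ ⟨a', b', c'⟩ h
    simpa using h
  · rintro ⟨a, b⟩ ⟨a', b'⟩ h
    simpa using h
  · rintro b c h
    exact Fin.succ_ne_zero _ (congrArg Prod.fst h)

lemma invBelow_permCons_zero {n : ℕ} (w : Fin (n + 1)) (σ : Equiv.Perm (Fin n)) (m : ℕ)
    (j : Fin n) :
    InvBelow (permCons w σ) m (0, j.succ) ↔ (σ j : ℕ) < w ∧ (w : ℕ) < m := by
  simp [InvBelow, succAbove_lt_self_iff]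

lemma invBelow_permCons_succ {n : ℕ} (w : Fin (n + 1)) (σ : Equiv.Perm (Fin n)) (m : ℕ)
    (p : Fin n × Fin n) :
    InvBelow (permCons w σ) m (p.1.succ, p.2.succ) ↔
      p.1 < p.2 ∧ σ p.2 < σ p.1 ∧ (w.succAbove (σ p.1) : ℕ) < m := by
  simp [InvBelow]

lemma invBelow_permCons_succ_of_le {n : ℕ} {w : Fin (n + 1)} (σ : Equiv.Perm (Fin n)) {m : ℕ}
    (hm : m ≤ w) (p : Fin n × Fin n) :
    InvBelow (permCons w σ) m (p.1.succ, p.2.succ) ↔ InvBelow σ m p := by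
  rw [invBelow_permCons_succ, InvBelow, val_succAbove]
  split_ifs <;> grind

lemma invBelow_permCons_succ_of_gt {n : ℕ} {w : Fin (n + 1)} (σ : Equiv.Perm (Fin n)) {m : ℕ}
    (hw : (w : ℕ) ≤ 1) (p : Fin n × Fin n) :
    InvBelow (permCons w σ) (m + 1) (p.1.succ, p.2.succ) ↔ InvBelow σ m p := by
  rw [invBelow_permCons_succ, InvBelow, val_succAbove]
  simp only [Fin.lt_def]
  split_ifs <;> omega

lemma invBelow_mem_ranges {n : ℕ} (π : Equiv.Perm (Fin (n + 1))) (m : ℕ)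
    (p : Fin (n + 1) × Fin (n + 1)) (h : InvBelow π m p) :
    (∃ b : Fin n, (0, b.succ) = p) ∨ ∃ c : Fin n × Fin n, (c.1.succ, c.2.succ) = p := by
  obtain ⟨i, j⟩ := p
  obtain ⟨h1, -⟩ := h
  dsimp only at h1
  obtain ⟨j, rfl⟩ := Fin.exists_succ_eq.2 (Fin.ne_zero_of_lt h1)
  rcases Fin.eq_zero_or_eq_succ i with rfl | ⟨i, rfl⟩
  · exact Or.inl ⟨j, rfl⟩
  · exact Or.inr ⟨(i, j), rfl⟩

lemma noInvBelow_permCons {n : ℕ} (w : Fin (n + 1)) (σ : Equiv.Perm (Fin n)) (m : ℕ) :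
    NoInvBelow (permCons w σ) m ↔ ((w : ℕ) = 0 ∨ m ≤ w) ∧
      ∀ p : Fin n × Fin n, ¬ InvBelow (permCons w σ) m (p.1.succ, p.2.succ) := by
  constructor
  · refine fun h => ⟨?_, fun p => h _⟩
    by_contra! hw
    have hn : 0 < n := by omega
    refine h (0, (σ.symm ⟨0, hn⟩).succ) ((invBelow_permCons_zero w σ m _).2 ?_)
    rw [Equiv.apply_symm_apply]
    exact ⟨Nat.pos_of_ne_zero hw.1, hw.2⟩
  · rintro ⟨h1, h2⟩ p hp
    rcases invBelow_mem_ranges _ m p hp with ⟨b, rfl⟩ | ⟨c, rfl⟩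
    · rw [invBelow_permCons_zero] at hp
      omega
    · exact h2 _ hp

lemma noInvBelow_permCons_of_eq_zero {n : ℕ} {w : Fin (n + 1)} (hw : (w : ℕ) = 0)
    (σ : Equiv.Perm (Fin n)) (m : ℕ) :
    NoInvBelow (permCons w σ) (m + 1) ↔ NoInvBelow σ m := by
  rw [noInvBelow_permCons]
  simp only [invBelow_permCons_succ_of_gt σ (show (w : ℕ) ≤ 1 by omega), hw, true_or, true_and]
  rfl

lemma noInvBelow_permCons_of_le {n : ℕ} {w : Fin (n + 1)} {m : ℕ} (hw : m ≤ w)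
    (σ : Equiv.Perm (Fin n)) :
    NoInvBelow (permCons w σ) m ↔ NoInvBelow σ m := by
  rw [noInvBelow_permCons]
  simp only [invBelow_permCons_succ_of_le σ hw, hw, or_true, true_and]
  rfl

lemma oneInvBelow_permCons {n : ℕ} (w : Fin (n + 1)) (σ : Equiv.Perm (Fin n)) (m : ℕ) :
    OneInvBelow (permCons w σ) m ↔
      ((∃! j, (σ j : ℕ) < w ∧ (w : ℕ) < m) ∧
        ∀ p : Fin n × Fin n, ¬ InvBelow (permCons w σ) m (p.1.succ, p.2.succ)) ∨
      ((∀ j, ¬ ((σ j : ℕ) < w ∧ (w : ℕ) < m)) ∧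
        ∃! p : Fin n × Fin n, InvBelow (permCons w σ) m (p.1.succ, p.2.succ)) := by
  unfold OneInvBelow
  rw [existsUnique_iff_of_ranges (fun b : Fin n => ((0 : Fin (n + 1)), b.succ))
    (fun c : Fin n × Fin n => (c.1.succ, c.2.succ)) ?_ ?_ ?_ (invBelow_mem_ranges _ m)]
  · simp only [invBelow_permCons_zero]
  · intro a b h
    simpa using h
  · rintro ⟨a, b⟩ ⟨a', b'⟩ h
    simpa using h
  · rintro b c h
    exact Fin.succ_ne_zero _ (congrArg Prod.fst h).symm

lemma oneInvBelow_permCons_of_eq_zero {n : ℕ} {w : Fin (n + 1)} (hw : (w : ℕ) = 0)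
    (σ : Equiv.Perm (Fin n)) (m : ℕ) :
    OneInvBelow (permCons w σ) (m + 1) ↔ OneInvBelow σ m := by
  rw [oneInvBelow_permCons]
  simp only [invBelow_permCons_succ_of_gt σ (show (w : ℕ) ≤ 1 by omega), hw]
  simp [OneInvBelow, ExistsUnique]

lemma oneInvBelow_permCons_of_eq_one {n : ℕ} {w : Fin (n + 1)} (hw : (w : ℕ) = 1)
    (σ : Equiv.Perm (Fin n)) (m : ℕ) :
    OneInvBelow (permCons w σ) (m + 2) ↔ NoInvBelow σ (m + 1) := by
  have hn : 0 < n := by omega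
  rw [oneInvBelow_permCons]
  simp only [invBelow_permCons_succ_of_gt σ hw.le, hw]
  have h0 : ((σ (σ.symm ⟨0, hn⟩) : Fin n) : ℕ) < 1 ∧ 1 < m + 2 := by simp
  have h1 : ∃! j, (σ j : ℕ) < 1 ∧ 1 < m + 2 := by
    refine ⟨_, h0, fun j hj => ?_⟩
    rw [Equiv.eq_symm_apply]
    ext
    simpa using hj.1
  constructor
  · rintro (h | h)
    · exact h.2
    · exact absurd h0 (h.1 _)
  · exact fun h => Or.inl ⟨h1, h⟩

lemma not_oneInvBelow_permCons {n : ℕ} {w : Fin (n + 1)} (hw : 2 ≤ (w : ℕ))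
    {σ : Equiv.Perm (Fin n)} (hσ : NoInvBelow σ w) (m : ℕ) :
    ¬ OneInvBelow (permCons w σ) m := by
  rw [oneInvBelow_permCons]
  have hn : 1 < n := by omega
  rcases lt_or_ge (w : ℕ) m with h | h
  · have h0 : ((σ (σ.symm ⟨0, by omega⟩) : Fin n) : ℕ) < w ∧ (w : ℕ) < m := by
      rw [Equiv.apply_symm_apply]
      exact ⟨by dsimp only; omega, h⟩
    have h1 : ((σ (σ.symm ⟨1, hn⟩) : Fin n) : ℕ) < w ∧ (w : ℕ) < m := by
      rw [Equiv.apply_symm_apply]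
      exact ⟨by dsimp only; omega, h⟩
    rintro (h' | h')
    · have := h'.1.unique h0 h1
      simp at this
    · exact h'.1 _ h0
  · rintro (⟨⟨j, hj, -⟩, -⟩ | ⟨-, ⟨p, hp, -⟩⟩)
    · omega
    · rw [invBelow_permCons_succ_of_le σ h] at hp
      exact hσ.mono h p hp

/-- The number of 321-avoiding permutations without inversions below `m`. -/
noncomputable def avoidCount (n m : ℕ) : ℕ :=
  permCount (n := n) (fun σ => Avoids321 σ ∧ NoInvBelow σ m)

/-- The number of permutations with exactly one 321 and without inversions below `m`. -/
noncomputable def oneCount (n m : ℕ) : ℕ :=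
  permCount (n := n) (fun σ => ExactlyOne321 σ ∧ NoInvBelow σ m)

/-- The number of 321-avoiding permutations with exactly one inversion below `v` and without
inversions below `m`. -/
noncomputable def oneInvCount (n v m : ℕ) : ℕ :=
  permCount (n := n) (fun σ => Avoids321 σ ∧ OneInvBelow σ v ∧ NoInvBelow σ m)

lemma avoidCount_one (n : ℕ) : avoidCount n 1 = avoidCount n 0 :=
  permCount_congr fun σ => by simp [noInvBelow_of_le_one]

lemma oneCount_one (n : ℕ) : oneCount n 1 = oneCount n 0 :=
  permCount_congr fun σ => by simp [noInvBelow_of_le_one]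

lemma oneInvCount_one (n v : ℕ) : oneInvCount n v 1 = oneInvCount n v 0 :=
  permCount_congr fun σ => by simp [noInvBelow_of_le_one]

lemma oneInvCount_self (n v : ℕ) : oneInvCount n v v = 0 :=
  permCount_eq_zero fun _ h => h.2.1.not_noInvBelow h.2.2

lemma avoidCount_zero_left (m : ℕ) : avoidCount 0 m = 1 := by
  have h : ∀ σ : Equiv.Perm (Fin 0), (Avoids321 σ ∧ NoInvBelow σ m) ↔ True := fun σ =>
    iff_true_intro ⟨fun t => t.1.elim0, fun p => p.1.elim0⟩
  rw [avoidCount, permCount_congr h, permCount]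
  simp

lemma oneCount_zero_left (m : ℕ) : oneCount 0 m = 0 :=
  permCount_eq_zero fun _ h => h.1.choose.1.elim0

lemma avoidCount_succ (n m : ℕ) :
    avoidCount (n + 1) (m + 1) = avoidCount n m +
      ∑ v ∈ Finset.range n, if m ≤ v then avoidCount n (v + 1) else 0 := by
  have key : ∀ v : Fin (n + 1),
      permCount (fun σ => Avoids321 (permCons v σ) ∧ NoInvBelow (permCons v σ) (m + 1)) =
        (fun v : ℕ => if v = 0 then avoidCount n m else
          if m + 1 ≤ v then avoidCount n v else 0) v := by
    intro v
    dsimp only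
    split_ifs with h0 h1
    · refine permCount_congr fun σ => ?_
      rw [avoids321_permCons, noInvBelow_permCons_of_eq_zero h0, h0]
      simp [noInvBelow_of_le_one]
    · refine permCount_congr fun σ => ?_
      rw [avoids321_permCons, noInvBelow_permCons_of_le h1]
      exact ⟨fun h => h.1, fun h => ⟨h, h.2.mono h1⟩⟩
    · refine permCount_eq_zero fun σ h => ?_
      rw [noInvBelow_permCons] at h
      omega
  rw [avoidCount, permCount_succ, Finset.sum_congr rfl (fun v _ => key v),
    Fin.sum_univ_eq_sum_range (fun v : ℕ => if v = 0 then avoidCount n m else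
          if m + 1 ≤ v then avoidCount n v else 0), Finset.sum_range_succ']
  simp [add_comm]

lemma oneCount_succ (n m : ℕ) :
    oneCount (n + 1) (m + 1) = oneCount n m +
      ∑ v ∈ Finset.range n,
        if m ≤ v then oneCount n (v + 1) + oneInvCount n (v + 1) (m + 1) else 0 := by
  have key : ∀ v : Fin (n + 1),
      permCount (fun σ => ExactlyOne321 (permCons v σ) ∧ NoInvBelow (permCons v σ) (m + 1)) =
        (fun v : ℕ => if v = 0 then oneCount n m else
          if m + 1 ≤ v then oneCount n v + oneInvCount n v (m + 1) else 0) v := by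
    intro v
    dsimp only
    split_ifs with h0 h1
    · refine permCount_congr fun σ => ?_
      rw [exactlyOne321_permCons, noInvBelow_permCons_of_eq_zero h0, h0]
      have h := noInvBelow_of_le_one σ zero_le_one
      have h' : ¬ OneInvBelow σ 0 := fun h' => h'.not_noInvBelow h
      simp [h, h']
    · rw [oneCount, oneInvCount, ← permCount_or]
      · refine permCount_congr fun σ => ?_
        rw [exactlyOne321_permCons, noInvBelow_permCons_of_le h1]
        have : NoInvBelow σ v → NoInvBelow σ (m + 1) := fun h => h.mono h1
        tauto
      · exact fun σ h h' => h'.2.1.not_noInvBelow h.2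
    · refine permCount_eq_zero fun σ h => ?_
      rw [noInvBelow_permCons] at h
      omega
  rw [oneCount, permCount_succ, Finset.sum_congr rfl (fun v _ => key v),
    Fin.sum_univ_eq_sum_range (fun v : ℕ => if v = 0 then oneCount n m else
          if m + 1 ≤ v then oneCount n v + oneInvCount n v (m + 1) else 0),
    Finset.sum_range_succ']
  simp [add_comm]

lemma oneInvCount_succ (n v m : ℕ) (hn : 1 ≤ n) :
    oneInvCount (n + 1) (v + 2) (m + 1) = oneInvCount n (v + 1) m +
      if m = 0 then avoidCount n (v + 1) else 0 := by
  have key : ∀ w : Fin (n + 1),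
      permCount (fun σ => Avoids321 (permCons w σ) ∧ OneInvBelow (permCons w σ) (v + 2) ∧
          NoInvBelow (permCons w σ) (m + 1)) =
        (fun w : ℕ => if w = 0 then oneInvCount n (v + 1) m else
          if w = 1 ∧ m = 0 then avoidCount n (v + 1) else 0) w := by
    intro w
    dsimp only
    split_ifs with h0 h1
    · refine permCount_congr fun σ => ?_
      rw [avoids321_permCons, noInvBelow_permCons_of_eq_zero h0,
        oneInvBelow_permCons_of_eq_zero h0, h0]
      simp [noInvBelow_of_le_one]
    · refine permCount_congr fun σ => ?_
      rw [avoids321_permCons, oneInvBelow_permCons_of_eq_one h1.1, h1.1, h1.2]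
      simp [noInvBelow_of_le_one]
    · refine permCount_eq_zero fun σ h => ?_
      rcases Nat.lt_or_ge w 2 with h2 | h2
      · rw [noInvBelow_permCons] at h
        omega
      · exact not_oneInvBelow_permCons h2 ((avoids321_permCons _ _).1 h.1).2 _ h.2.1
  obtain ⟨n, rfl⟩ := Nat.exists_eq_add_of_le' hn
  rw [oneInvCount, permCount_succ, Finset.sum_congr rfl (fun v _ => key v),
    Fin.sum_univ_eq_sum_range (fun w : ℕ => if w = 0 then oneInvCount (n + 1) (v + 1) m else
          if w = 1 ∧ m = 0 then avoidCount (n + 1) (v + 1) else 0),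
    Finset.sum_range_succ', Finset.sum_range_succ']
  simp [add_comm]

lemma sum_range_ite_le {M : Type*} [AddCommMonoid M] (n m : ℕ) (hm : m < n) (f : ℕ → M) :
    (∑ v ∈ Finset.range n, if m ≤ v then f v else 0) =
      f m + ∑ v ∈ Finset.range n, if m + 1 ≤ v then f v else 0 := by
  have h : ∀ v ∈ Finset.range n, (if m ≤ v then f v else 0) =
      (if m = v then f m else 0) + if m + 1 ≤ v then f v else 0 := by
    intro v _
    rcases lt_trichotomy m v with h | rfl | h
    · simp [h.le, h.ne, Nat.succ_le_of_lt h]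
    · simp
    · simp [h.not_ge, h.ne', show ¬ m + 1 ≤ v by omega]
  rw [Finset.sum_congr rfl h, Finset.sum_add_distrib, Finset.sum_ite_eq]
  simp [hm]

lemma sum_range_ite_self {M : Type*} [AddCommMonoid M] (n : ℕ) (f : ℕ → M) :
    (∑ v ∈ Finset.range n, if n ≤ v then f v else 0) = 0 :=
  Finset.sum_eq_zero fun _ hv => if_neg (Finset.mem_range.1 hv).not_ge

lemma avoidCount_self (n : ℕ) : avoidCount n n = 1 := by
  induction n with
  | zero => exact avoidCount_zero_left 0
  | succ n ih => rw [avoidCount_succ, sum_range_ite_self, ih, add_zero]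

lemma avoidCount_pascal (n m : ℕ) (hm : m < n) :
    avoidCount (n + 1) (m + 1) = avoidCount n m + avoidCount (n + 1) (m + 2) := by
  rw [avoidCount_succ, avoidCount_succ n (m + 1),
    sum_range_ite_le n m hm (fun v => avoidCount n (v + 1))]

/-- The contribution to `oneCount (n + 1) (m + 1)` of the occurrences of 321 that involve
the first position. -/
noncomputable def oneInvSum (n m : ℕ) : ℕ :=
  ∑ v ∈ Finset.range n, if m ≤ v then oneInvCount n (v + 1) (m + 1) else 0

lemma oneInvSum_succ_succ (n m : ℕ) : oneInvSum (n + 1) (m + 1) = oneInvSum n m := by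
  unfold oneInvSum
  rw [Finset.sum_range_succ']
  simp only [Nat.add_le_add_iff_right, Nat.le_zero, Nat.succ_ne_zero, if_false, add_zero]
  refine Finset.sum_congr rfl fun v hv => ?_
  rw [oneInvCount_succ n v (m + 1) (by have := Finset.mem_range.1 hv; omega)]
  simp

lemma oneInvSum_zero_right (n : ℕ) : oneInvSum n 0 + 1 = avoidCount n 0 := by
  induction n with
  | zero => simp [oneInvSum, avoidCount_zero_left]
  | succ n ih =>
    have h : oneInvSum (n + 1) 0 = oneInvSum n 0 +
        ∑ v ∈ Finset.range n, avoidCount n (v + 1) := by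
      unfold oneInvSum
      rw [Finset.sum_range_succ']
      simp only [Nat.zero_le, if_true, zero_add, oneInvCount_self, add_zero]
      rw [← Finset.sum_add_distrib]
      refine Finset.sum_congr rfl fun v hv => ?_
      have hvn := oneInvCount_succ n v 0 (by have := Finset.mem_range.1 hv; omega)
      rw [if_pos rfl, zero_add, ← oneInvCount_one] at hvn
      exact hvn
    have h' := avoidCount_succ n 0
    simp only [Nat.zero_le, if_true, zero_add] at h'
    rw [avoidCount_one] at h'
    omega

lemma oneInvSum_add (m k : ℕ) : oneInvSum (m + k) m + 1 = avoidCount k 0 := by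
  induction m with
  | zero => rw [zero_add, oneInvSum_zero_right]
  | succ m ih => rw [add_right_comm, oneInvSum_succ_succ, ih]

lemma oneCount_succ' (n m : ℕ) :
    oneCount (n + 1) (m + 1) = oneCount n m +
      (∑ v ∈ Finset.range n, if m ≤ v then oneCount n (v + 1) else 0) + oneInvSum n m := by
  rw [oneCount_succ, oneInvSum, add_assoc, ← Finset.sum_add_distrib]
  congr 1
  refine Finset.sum_congr rfl fun v _ => ?_
  split_ifs <;> rfl

lemma oneCount_self (n : ℕ) : oneCount n n = 0 := by
  induction n with
  | zero => exact oneCount_zero_left 0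
  | succ n ih =>
    rw [oneCount_succ', sum_range_ite_self, oneInvSum, sum_range_ite_self, ih, add_zero, add_zero]

/-- The ballot numbers. -/
noncomputable def ballot (m k : ℕ) : ℚ := avoidCount (m + k) m

lemma ballot_zero (m : ℕ) : ballot m 0 = 1 := by
  simp [ballot, avoidCount_self]

lemma ballot_zero_succ (k : ℕ) : ballot 0 (k + 1) = ballot 1 k := by
  rw [ballot, ballot, zero_add, add_comm 1 k, avoidCount_one]

lemma ballot_succ_succ (m k : ℕ) :
    ballot (m + 1) (k + 1) = ballot m (k + 1) + ballot (m + 2) k := by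
  have h := avoidCount_pascal (m + (k + 1)) m (by omega)
  simp only [ballot]
  rw [show m + 1 + (k + 1) = m + (k + 1) + 1 by ring, h,
    show m + 2 + k = m + (k + 1) + 1 by ring]
  push_cast
  ring

lemma ballot_eq (k m : ℕ) :
    ballot m k = (m + 1) / (m + k + 1) * Nat.choose (m + 2 * k) k := by
  induction k generalizing m with
  | zero =>
    rw [ballot_zero]
    push_cast
    rw [Nat.choose_zero_right]
    field_simp
    simp
  | succ k ih =>
    induction m with
    | zero =>
      have h := Nat.choose_succ_succ' (2 * k + 1) k
      rw [Nat.choose_symm_half] at h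
      rw [ballot_zero_succ, ih, show 0 + 2 * (k + 1) = 2 * k + 1 + 1 by ring, h,
        show 1 + 2 * k = 2 * k + 1 by ring]
      push_cast
      field_simp
      ring
    | succ m ihm =>
      have h := Nat.choose_succ_succ' (m + 2 * (k + 1)) k
      have h' := Nat.choose_succ_right_eq (m + 2 * (k + 1)) k
      rw [show m + 2 * (k + 1) - k = m + k + 2 by omega] at h'
      have h'' : ((m + 2 * (k + 1)).choose (k + 1) : ℚ) =
          (m + 2 * (k + 1)).choose k * (m + k + 2) / (k + 1) := by
        rw [eq_div_iff (by positivity)]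
        exact_mod_cast h'
      rw [ballot_succ_succ, ih, ihm,
        show m + 1 + 2 * (k + 1) = m + 2 * (k + 1) + 1 by ring, h,
        show m + 2 + 2 * k = m + 2 * (k + 1) by ring]
      push_cast
      rw [h'']
      field_simp
      ring

lemma oneCount_add_succ_succ (m k : ℕ) :
    (oneCount (m + 1 + (k + 1)) (m + 1) : ℚ) = oneCount (m + 2 + k) (m + 2) +
      oneCount (m + (k + 1)) m + ballot 0 (k + 1) - ballot 0 k := by
  have h1 := oneCount_succ' (m + (k + 1)) m
  have h2 := oneCount_succ' (m + (k + 1)) (m + 1)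
  rw [sum_range_ite_le _ m (by omega) (fun v => oneCount (m + (k + 1)) (v + 1))] at h1
  have h3 := oneInvSum_add m (k + 1)
  have h4 := oneInvSum_add (m + 1) k
  rw [show m + 1 + k = m + (k + 1) by ring] at h4
  rw [show m + 1 + (k + 1) = m + (k + 1) + 1 by ring,
    show m + 2 + k = m + (k + 1) + 1 by ring, ballot, ballot, zero_add, zero_add,
    ← h3, ← h4, h1, h2]
  push_cast
  ring

lemma oneCount_add_one (m : ℕ) : oneCount (m + 1) m = 0 := by
  induction m with
  | zero => rw [zero_add, ← oneCount_one, oneCount_self]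
  | succ m ih =>
    have h := oneCount_add_succ_succ m 0
    rw [zero_add, ih, add_zero, oneCount_self, ballot_zero_succ, ballot_zero, ballot_zero] at h
    simpa using h

lemma oneCount_add_two (k m : ℕ) :
    (oneCount (m + (k + 2)) m : ℚ) =
      ballot (m + 4) k + ballot (m + 1) (k + 1) - ballot 2 (k + 1) := by
  induction k generalizing m with
  | zero =>
    induction m with
    | zero =>
      have h := oneCount_add_one 1
      rw [oneCount_one] at h
      rw [zero_add, zero_add, h, ballot_succ_succ 1 0, ballot_zero, ballot_zero]
      push_cast
      ring
    | succ m ih =>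
      have h := oneCount_add_succ_succ m 1
      rw [oneCount_add_one, ih] at h
      rw [show m + 1 + (0 + 2) = m + 1 + (1 + 1) by ring, h, zero_add]
      have h1 := ballot_succ_succ (m + 1) 0
      have h2 := ballot_succ_succ 0 0
      have h3 := ballot_zero_succ 1
      simp only [ballot_zero, zero_add] at h1 h2 h3 ⊢
      push_cast
      linarith
  | succ k ih =>
    induction m with
    | zero =>
      have h := ih 1
      rw [show 1 + (k + 2) = k + 3 by ring, oneCount_one] at h
      rw [show 0 + (k + 1 + 2) = k + 3 by ring, h]
      have h1 := ballot_succ_succ 1 (k + 1)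
      have h2 := ballot_succ_succ 3 k
      norm_num at h1 h2 ⊢
      linarith
    | succ m ihm =>
      have h := oneCount_add_succ_succ m (k + 2)
      rw [ih (m + 2), ihm] at h
      rw [show m + 1 + (k + 1 + 2) = m + 1 + (k + 2 + 1) by ring, h]
      have h1 := ballot_succ_succ (m + 4) k
      have h2 := ballot_succ_succ (m + 1) (k + 1)
      have h3 := ballot_zero_succ (k + 2)
      have h4 := ballot_succ_succ 0 (k + 1)
      simp only [add_assoc, Nat.reduceAdd, zero_add] at h1 h2 h3 h4 ⊢
      linarith

theorem noonan (n : ℕ) (hn : 1 ≤ n) :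
    (Nat.card {π : Equiv.Perm (Fin n) // ExactlyOne321 π} : ℚ) =
      3 / n * Nat.choose (2 * n) (n + 3) := by
  have h : Nat.card {π : Equiv.Perm (Fin n) // ExactlyOne321 π} = oneCount n 0 :=
    permCount_congr fun σ => by simp [noInvBelow_of_le_one]
  rw [h]
  obtain rfl | ⟨k, rfl⟩ : n = 1 ∨ ∃ k, n = k + 2 := by
    rcases Nat.lt_or_ge n 2 with h | h
    · exact Or.inl (by omega)
    · exact Or.inr (Nat.exists_eq_add_of_le' h)
  · have := oneCount_add_one 0
    simp_all [Nat.choose]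
  · have := oneCount_add_two k 0
    rw [zero_add] at this
    rw [this]
    simp only [ballot_eq]
    have h1 := Nat.choose_succ_right_eq (2 * (k + 2)) (k + 4)
    have h2 := Nat.choose_succ_right_eq (2 * (k + 2)) k
    have h3 := Nat.choose_succ_right_eq (2 * (k + 2)) (k + 1)
    have h4 := Nat.choose_succ_succ' (2 * (k + 1) + 1) (k + 1)
    rw [Nat.choose_symm_half] at h4
    have h5 : (2 * (k + 2)).choose (k + 4) = (2 * (k + 2)).choose k :=
      Nat.choose_symm_of_eq_add (by ring)
    rw [show 2 * (k + 2) - (k + 4) = k by omega, h5] at h1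
    rw [show 2 * (k + 2) - k = k + 4 by omega] at h2
    rw [show 2 * (k + 2) - (k + 1) = k + 3 by omega] at h3
    rw [show 2 * (k + 1) + 1 + 1 = 2 * (k + 2) by ring] at h4
    rw [show k + 2 + 3 = k + 4 + 1 by ring, show 0 + 4 + 2 * k = 2 * (k + 2) by ring,
      show 0 + 1 + 2 * (k + 1) = 2 * (k + 1) + 1 by ring,
      show 2 + 2 * (k + 1) = 2 * (k + 2) by ring]
    generalize (2 * (k + 2)).choose k = a at *
    generalize (2 * (k + 2)).choose (k + 1) = b at *
    generalize (2 * (k + 2)).choose (k + 4 + 1) = c at *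
    generalize (2 * (k + 1) + 1).choose (k + 1) = d at *
    rw [h4] at h3
    have hb : (b : ℚ) = a * (k + 4) / (k + 1) := by
      rw [eq_div_iff (by positivity)]
      exact_mod_cast h2
    have hc : (c : ℚ) = a * k / (k + 5) := by
      rw [eq_div_iff (by positivity)]
      exact_mod_cast h1
    have hd : (d : ℚ) = b * (k + 3) / (2 * (k + 2)) := by
      rw [eq_div_iff (by positivity)]
      have : ((d : ℚ) + d) * (k + 1 + 1) = b * (k + 3) := by exact_mod_cast h3
      linarith
    rw [hd, hb, hc]
    push_cast
    field_simp
    ring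
end

section
/- For every integer n ≥ 1, the number of permutations of {1, 2, …, n} that contain the pattern 321 exactly once equals the sum over b from 2 to n−1 of (C_b − C_{b−1})·(C_{n−b+1} − C_{n−b}), where C_m denotes the m-th Catalan number. -/
open Finset

section Insertion

variable {n : ℕ}

/-- The permutation of `Fin (n + 1)` whose one-line notation is `v` followed by that of `σ`,
relabelled by the values other than `v`. -/
def consPerm (v : Fin (n + 1)) (σ : Equiv.Perm (Fin n)) : Equiv.Perm (Fin (n + 1)) :=
  (Equiv.Perm.decomposeFin.symm (0, σ)).trans v.cycleRange.symm

@[simp]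
theorem consPerm_zero (v : Fin (n + 1)) (σ : Equiv.Perm (Fin n)) : consPerm v σ 0 = v := by
  simp [consPerm]

@[simp]
theorem consPerm_succ (v : Fin (n + 1)) (σ : Equiv.Perm (Fin n)) (i : Fin n) :
    consPerm v σ i.succ = v.succAbove (σ i) := by
  simp [consPerm]

theorem consPerm_bijective :
    Function.Bijective fun x : Fin (n + 1) × Equiv.Perm (Fin n) => consPerm x.1 x.2 := by
  rw [Fintype.bijective_iff_injective_and_card]
  refine ⟨?_, by simp [Fintype.card_perm, Nat.factorial_succ]⟩
  rintro ⟨v, σ⟩ ⟨w, τ⟩ h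
  have hvw : v = w := by simpa using congrArg (fun π : Equiv.Perm _ => π 0) h
  subst hvw
  refine Prod.ext rfl (Equiv.ext fun i => ?_)
  simpa using congrArg (fun π : Equiv.Perm _ => π i.succ) h

theorem card_filter_consPerm (p : Equiv.Perm (Fin (n + 1)) → Prop) [DecidablePred p] :
    #{π | p π} = ∑ v, #{σ | p (consPerm v σ)} := by
  simp only [card_filter]
  rw [← consPerm_bijective.sum_comp, Fintype.sum_prod_type]

instance (π : Equiv.Perm (Fin n)) : DecidablePred (Occ321 π) := fun t => by
  unfold Occ321
  infer_instance

/-- The number of occurrences of the pattern 321. -/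
def num321 (π : Equiv.Perm (Fin n)) : ℕ := #{t | Occ321 π t}

/-- The number of inversions whose larger value is less than `k`. -/
def invBelow (k : ℕ) (π : Equiv.Perm (Fin n)) : ℕ :=
  ∑ i, ∑ j, if i < j ∧ π j < π i ∧ (π i : ℕ) < k then 1 else 0

theorem num321_eq_sum (π : Equiv.Perm (Fin n)) :
    num321 π = ∑ i, ∑ j, ∑ l, if i < j ∧ j < l ∧ π j < π i ∧ π l < π j then 1 else 0 := by
  rw [num321, card_filter]
  simp only [Fintype.sum_prod_type, Occ321]

theorem exactlyOne321_iff (π : Equiv.Perm (Fin n)) : ExactlyOne321 π ↔ num321 π = 1 := by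
  simp [num321, card_eq_one, singleton_iff_unique_mem, ExactlyOne321]

theorem invBelow_mono {k l : ℕ} (h : k ≤ l) (π : Equiv.Perm (Fin n)) :
    invBelow k π ≤ invBelow l π := by
  refine sum_le_sum fun i _ => sum_le_sum fun j _ => ?_
  split_ifs <;> omega

theorem invBelow_one (π : Equiv.Perm (Fin n)) : invBelow 1 π = 0 := by
  simp only [invBelow, sum_eq_zero_iff]
  intro i _ j _
  rw [if_neg]
  rintro ⟨-, h, h'⟩
  have := Fin.lt_def.mp h
  omega

theorem invBelow_zero (π : Equiv.Perm (Fin n)) : invBelow 0 π = 0 := by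
  simp [invBelow]

theorem succAbove_val_lt_iff (v : Fin (n + 1)) (x : Fin n) (k : ℕ) :
    (v.succAbove x : ℕ) < k ↔ (x : ℕ) < if (v : ℕ) < k then k - 1 else k := by
  simp only [Fin.succAbove, Fin.lt_def]
  split_ifs <;> simp_all <;> omega

theorem invBelow_consPerm (k : ℕ) (v : Fin (n + 1)) (σ : Equiv.Perm (Fin n)) :
    invBelow k (consPerm v σ) =
      (if (v : ℕ) < k then (v : ℕ) else 0) + invBelow (if (v : ℕ) < k then k - 1 else k) σ := by
  rw [invBelow, Fin.sum_univ_succ]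
  congr 1
  · simp only [Fin.sum_univ_succ, consPerm_zero, consPerm_succ, lt_irrefl, false_and, if_false,
      zero_add, Fin.succ_pos, true_and, Fin.succAbove_lt_iff_castSucc_lt]
    rw [Equiv.sum_comp σ fun x => if x.castSucc < v ∧ (v : ℕ) < k then 1 else 0]
    split_ifs with h
    · simp only [h, and_true, ← card_filter]
      simp only [Fin.lt_def, Fin.val_castSucc, Fin.card_filter_val_lt]
      omega
    · simp [h]
  · simp only [invBelow, Fin.sum_univ_succ, consPerm_succ, Fin.not_lt_zero, false_and, if_false,
      zero_add, Fin.succ_lt_succ_iff, Fin.succAbove_lt_succAbove_iff, succAbove_val_lt_iff]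

theorem num321_consPerm (v : Fin (n + 1)) (σ : Equiv.Perm (Fin n)) :
    num321 (consPerm v σ) = invBelow v σ + num321 σ := by
  rw [num321_eq_sum, Fin.sum_univ_succ]
  congr 1
  · simp only [invBelow, Fin.sum_univ_succ, consPerm_zero, consPerm_succ, Fin.not_lt_zero,
      lt_irrefl, false_and, and_false, if_false, zero_add, Fin.succ_pos, true_and,
      Fin.succ_lt_succ_iff, Fin.succAbove_lt_succAbove_iff, Fin.succAbove_lt_iff_castSucc_lt,
      sum_const_zero]
    refine sum_congr rfl fun i _ => sum_congr rfl fun j _ => if_congr ?_ rfl rfl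
    simp only [Fin.lt_def, Fin.val_castSucc]
    tauto
  · simp only [num321_eq_sum, Fin.sum_univ_succ, consPerm_succ, Fin.not_lt_zero,
      false_and, and_false, if_false, zero_add, sum_const_zero,
      Fin.succ_lt_succ_iff, Fin.succAbove_lt_succAbove_iff]

end Insertion

section Counting

/-- The number of 321-avoiding permutations of `Fin n` in which the values less than `k`
appear in increasing order. -/
def numAvoiding (n k : ℕ) : ℕ :=
  #{π : Equiv.Perm (Fin n) | num321 π = 0 ∧ invBelow k π = 0}

/-- The number of permutations of `Fin n` with exactly one occurrence of 321 in which the values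
less than `k` appear in increasing order. -/
def numOnce (n k : ℕ) : ℕ :=
  #{π : Equiv.Perm (Fin n) | num321 π = 1 ∧ invBelow k π = 0}

/-- The number of 321-avoiding permutations of `Fin n` with exactly one inversion among the values
less than `v`, and none among the values less than `k`. -/
def numOneInv (n v k : ℕ) : ℕ :=
  #{π : Equiv.Perm (Fin n) | num321 π = 0 ∧ invBelow v π = 1 ∧ invBelow k π = 0}

theorem numAvoiding_one (n : ℕ) : numAvoiding n 1 = numAvoiding n 0 := by
  simp [numAvoiding, invBelow_one, invBelow_zero]

theorem numOnce_one (n : ℕ) : numOnce n 1 = numOnce n 0 := by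
  simp [numOnce, invBelow_one, invBelow_zero]

theorem numOneInv_one (n v : ℕ) : numOneInv n v 1 = numOneInv n v 0 := by
  simp [numOneInv, invBelow_one, invBelow_zero]

theorem numOneInv_zero (n k : ℕ) : numOneInv n 0 k = 0 := by
  simp [numOneInv, invBelow_zero]

theorem sum_univ_fin_ite (n k a : ℕ) (f : ℕ → ℕ) :
    ∑ v : Fin (n + 1), (if (v : ℕ) = 0 then a else if (v : ℕ) ≤ k then 0 else f v) =
      a + ∑ v ∈ Ico (k + 1) (n + 1), f v := by
  rw [Fin.sum_univ_eq_sum_range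
    (fun v => if v = 0 then a else if v ≤ k then 0 else f v), sum_range_eq_add_Ico _ (by omega)]
  simp only [if_true]
  congr 1
  have hsub : Ico (k + 1) (n + 1) ⊆ Ico 1 (n + 1) := Ico_subset_Ico_left (by omega)
  rw [← sum_subset hsub]
  · refine sum_congr rfl fun v hv => ?_
    rw [mem_Ico] at hv
    rw [if_neg (by omega), if_neg (by omega)]
  · intro v hv hv'
    rw [mem_Ico] at hv hv'
    rw [if_neg (by omega), if_pos (by omega)]

theorem numAvoiding_succ_succ (n k : ℕ) :
    numAvoiding (n + 1) (k + 1) =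
      numAvoiding n k + ∑ v ∈ Ico (k + 1) (n + 1), numAvoiding n v := by
  rw [numAvoiding, card_filter_consPerm, ← sum_univ_fin_ite]
  refine sum_congr rfl fun v _ => ?_
  simp only [num321_consPerm, invBelow_consPerm]
  rcases Nat.eq_zero_or_pos (v : ℕ) with h1 | h1
  · obtain rfl : v = 0 := Fin.ext h1
    simp [numAvoiding, invBelow_zero]
  rw [if_neg h1.ne']
  by_cases h2 : (v : ℕ) ≤ k
  · rw [if_pos h2, card_eq_zero, filter_eq_empty_iff]
    intro σ _
    rw [if_pos (by omega)]
    omega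
  · rw [if_neg h2]
    refine congrArg card (filter_congr fun σ _ => ?_)
    rw [if_neg (by omega), if_neg (by omega)]
    have := invBelow_mono (show k + 1 ≤ v by omega) σ
    omega

theorem numOnce_succ_succ (n k : ℕ) :
    numOnce (n + 1) (k + 1) = numOnce n k +
      ∑ v ∈ Ico (k + 1) (n + 1), (numOnce n v + numOneInv n v (k + 1)) := by
  rw [numOnce, card_filter_consPerm, ← sum_univ_fin_ite]
  refine sum_congr rfl fun v _ => ?_
  simp only [num321_consPerm, invBelow_consPerm]
  rcases Nat.eq_zero_or_pos (v : ℕ) with h1 | h1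
  · obtain rfl : v = 0 := Fin.ext h1
    simp [numOnce, invBelow_zero]
  rw [if_neg h1.ne']
  by_cases h2 : (v : ℕ) ≤ k
  · rw [if_pos h2, card_eq_zero, filter_eq_empty_iff]
    intro σ _
    rw [if_pos (by omega)]
    omega
  · rw [if_neg h2, numOnce, numOneInv, ← card_union_of_disjoint, ← filter_or]
    · refine congrArg card (filter_congr fun σ _ => ?_)
      rw [if_neg (by omega), if_neg (by omega)]
      have := invBelow_mono (show k + 1 ≤ v by omega) σ
      omega
    · rw [disjoint_filter]
      omega

theorem numOneInv_succ_succ {n v : ℕ} (hv : v ≤ n) (k : ℕ) :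
    numOneInv (n + 1) (v + 1) (k + 1) =
      numOneInv n v k + if k = 0 ∧ v ≠ 0 then numAvoiding n v else 0 := by
  have key : ∀ w : Fin (n + 1),
      #{σ | num321 (consPerm w σ) = 0 ∧ invBelow (v + 1) (consPerm w σ) = 1 ∧
        invBelow (k + 1) (consPerm w σ) = 0} =
      if (w : ℕ) = 0 then numOneInv n v k else if (w : ℕ) ≤ 0 then 0 else
        if (w : ℕ) = 1 then (if k = 0 ∧ v ≠ 0 then numAvoiding n v else 0) else 0 := by
    intro w
    simp only [num321_consPerm, invBelow_consPerm]
    have hempty : ¬ ((w : ℕ) = 0) → ¬ ((w : ℕ) = 1 ∧ k = 0 ∧ v ≠ 0) →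
        #{σ : Equiv.Perm (Fin n) | invBelow w σ + num321 σ = 0 ∧
          (if (w : ℕ) < v + 1 then (w : ℕ) else 0) +
            invBelow (if (w : ℕ) < v + 1 then v + 1 - 1 else v + 1) σ = 1 ∧
          (if (w : ℕ) < k + 1 then (w : ℕ) else 0) +
            invBelow (if (w : ℕ) < k + 1 then k + 1 - 1 else k + 1) σ = 0} = 0 := by
      intro h1 h2
      rw [card_eq_zero, filter_eq_empty_iff]
      rintro σ - ⟨h3, h4, h5⟩
      by_cases hw : (w : ℕ) < v + 1
      · rw [if_pos hw, if_pos hw] at h4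
        by_cases hw' : (w : ℕ) < k + 1
        · rw [if_pos hw', if_pos hw'] at h5
          omega
        · omega
      · rw [if_neg hw, if_neg hw] at h4
        have := invBelow_mono (show v + 1 ≤ w by omega) σ
        omega
    rcases Nat.eq_zero_or_pos (w : ℕ) with h1 | h1
    · obtain rfl : w = 0 := Fin.ext h1
      simp [numOneInv, invBelow_zero]
    rw [if_neg h1.ne', if_neg (by omega : ¬ (w : ℕ) ≤ 0)]
    by_cases h3 : (w : ℕ) = 1
    · by_cases h4 : k = 0 ∧ v ≠ 0
      · obtain ⟨rfl, h4⟩ := h4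
        rw [if_pos h3, if_pos (And.intro rfl h4)]
        refine congrArg card (filter_congr fun σ _ => ?_)
        rw [if_pos (by omega), if_pos (by omega), if_neg (by omega), if_neg (by omega), h3,
          invBelow_one]
        simp
      · rw [if_pos h3, if_neg h4]
        exact hempty h1.ne' fun h => h4 h.2
    · rw [if_neg h3]
      exact hempty h1.ne' fun h => h3 h.1
  rw [numOneInv, card_filter_consPerm, sum_congr rfl fun w _ => key w, sum_univ_fin_ite n 0 _
    (fun w => if w = 1 then (if k = 0 ∧ v ≠ 0 then numAvoiding n v else 0) else 0),
    sum_ite_eq']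
  congr 1
  split_ifs with h1 h2 h2
  · rfl
  · rfl
  · rw [mem_Ico] at h1
    omega
  · rfl

end Counting

section Series

open PowerSeries

/-- The Catalan generating function with integer coefficients. -/
noncomputable def catSeries : PowerSeries ℤ := catalanSeries.map (Nat.castRingHom ℤ)

theorem coeff_catSeries (n : ℕ) : coeff n catSeries = catalan n := by
  simp [catSeries]

theorem constantCoeff_catSeries : constantCoeff catSeries = 1 := by
  simpa using coeff_catSeries 0

theorem catSeries_eq : catSeries = 1 + X * catSeries ^ 2 := by
  have := congrArg (PowerSeries.map (Nat.castRingHom ℤ)) catalanSeries_sq_mul_X_add_one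
  simp only [map_add, map_mul, map_pow, map_one, PowerSeries.map_X] at this
  rw [catSeries]
  linear_combination -this

theorem coeff_catSeries_sq (n : ℕ) : coeff n (catSeries ^ 2) = (catalan (n + 1) : ℤ) := by
  have h : X * catSeries ^ 2 = catSeries - 1 := by linear_combination -catSeries_eq
  rw [← coeff_succ_X_mul, h]
  simp [coeff_catSeries, coeff_one]

theorem sum_range_coeff_eq {G : ℕ → PowerSeries ℤ} {R : PowerSeries ℤ}
    (hG : ∀ k, G (k + 1) = G k + X * G (k + 2) + R) (d k : ℕ) :
    ∑ i ∈ range (d + 1), coeff (d - i) (G (k + i)) + ∑ i ∈ range (d + 1), coeff i R =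
      coeff d (G (k + 1)) := by
  induction d generalizing k with
  | zero => simp [hG k]
  | succ d ih =>
    rw [sum_range_succ', sum_range_succ _ (d + 1), hG k]
    simp only [map_add, coeff_succ_X_mul, ← ih (k + 1), Nat.add_sub_add_right, Nat.sub_zero,
      add_zero, add_right_comm k, add_assoc k]
    ring

theorem sum_Ico_coeff_eq {G : ℕ → PowerSeries ℤ} {R : PowerSeries ℤ}
    (hG : ∀ k, G (k + 1) = G k + X * G (k + 2) + R) {n k : ℕ} (hk : k ≤ n) :
    ∑ v ∈ Ico k (n + 1), coeff (n - v) (G v) + ∑ i ∈ range (n - k + 1), coeff i R =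
      coeff (n - k) (G (k + 1)) := by
  rw [← sum_range_coeff_eq hG, sum_Ico_eq_sum_range, Nat.sub_add_comm hk]
  simp only [Nat.sub_add_eq]

theorem sum_Ico_coeff_pow {n k : ℕ} (hk : k ≤ n) :
    ∑ v ∈ Ico k (n + 1), coeff (n - v) (catSeries ^ (v + 1)) =
      coeff (n - k) (catSeries ^ (k + 2)) := by
  have := sum_Ico_coeff_eq (G := fun v => catSeries ^ (v + 1)) (R := 0)
    (fun k => by linear_combination catSeries ^ (k + 1) * catSeries_eq) hk
  simpa using this

theorem numAvoiding_eq {n k : ℕ} (hk : k ≤ n) :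
    (numAvoiding n k : ℤ) = coeff (n - k) (catSeries ^ (k + 1)) := by
  induction n generalizing k with
  | zero =>
    obtain rfl : k = 0 := by omega
    simp [numAvoiding, num321_eq_sum, invBelow, coeff_catSeries, -coeff_zero_eq_constantCoeff]
  | succ n ih =>
    have step : ∀ k ≤ n, (numAvoiding (n + 1) (k + 1) : ℤ) =
        coeff (n - k) (catSeries ^ (k + 2)) := by
      intro k hk
      rw [numAvoiding_succ_succ, ← sum_Ico_coeff_pow hk,
        sum_eq_sum_Ico_succ_bot (a := k) (by omega)]
      push_cast
      rw [ih hk]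
      congr 1
      refine sum_congr rfl fun v hv => ih ?_
      rw [mem_Ico] at hv
      omega
    cases k with
    | zero =>
      rw [← numAvoiding_one, step 0 (by omega)]
      simp only [Nat.sub_zero, zero_add, pow_one, coeff_catSeries_sq, coeff_catSeries]
    | succ k =>
      rw [step k (by omega), Nat.add_sub_add_right]

theorem numAvoiding_zero (n : ℕ) : (numAvoiding n 0 : ℤ) = catalan n := by
  simp [numAvoiding_eq, coeff_catSeries]

theorem sum_numOneInv_succ (n k : ℕ) :
    ∑ v ∈ Ico (k + 1) (n + 2), numOneInv (n + 1) v (k + 1) =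
      ∑ v ∈ Ico k (n + 1), numOneInv n v k +
        if k = 0 then ∑ v ∈ Ico 1 (n + 1), numAvoiding n v else 0 := by
  rw [← sum_Ico_add' (fun v => numOneInv (n + 1) v (k + 1)) k (n + 1) 1,
    sum_congr rfl fun v hv => numOneInv_succ_succ (by rw [mem_Ico] at hv; omega) k,
    sum_add_distrib]
  congr 1
  split_ifs with hk
  · subst hk
    rw [sum_eq_sum_Ico_succ_bot (by omega)]
    simp only [ne_eq, not_true_eq_false, and_false, if_false, zero_add, true_and]
    refine sum_congr rfl fun v hv => ?_
    rw [mem_Ico] at hv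
    rw [if_pos (by omega)]
  · simp [hk]

theorem sum_numOneInv_one (n : ℕ) :
    ∑ v ∈ Ico 1 (n + 1), numOneInv n v 1 = ∑ v ∈ Ico 0 (n + 1), numOneInv n v 0 := by
  rw [sum_eq_sum_Ico_succ_bot (a := 0) (by omega), numOneInv_zero, zero_add]
  exact sum_congr rfl fun v _ => numOneInv_one n v

theorem sum_numOneInv_zero (n : ℕ) :
    ((∑ v ∈ Ico 0 (n + 1), numOneInv n v 0 : ℕ) : ℤ) = catalan n - 1 := by
  induction n with
  | zero => simp [numOneInv_zero]
  | succ n ih =>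
    have h : (numAvoiding n 0 + ∑ v ∈ Ico 1 (n + 1), numAvoiding n v : ℤ) = catalan (n + 1) := by
      rw [← numAvoiding_zero (n + 1), ← numAvoiding_one (n + 1), numAvoiding_succ_succ]
      push_cast
      rfl
    rw [← sum_numOneInv_one, sum_numOneInv_succ n 0, if_pos rfl]
    rw [numAvoiding_zero] at h
    push_cast at h ih ⊢
    linarith

theorem sum_numOneInv_eq {n k : ℕ} (hk : k ≤ n) :
    ((∑ v ∈ Ico (k + 1) (n + 1), numOneInv n v (k + 1) : ℕ) : ℤ) = catalan (n - k) - 1 := by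
  induction k generalizing n with
  | zero => rw [zero_add, sum_numOneInv_one, sum_numOneInv_zero, Nat.sub_zero]
  | succ k ih =>
    obtain ⟨n, rfl⟩ : ∃ m, n = m + 1 := ⟨n - 1, by omega⟩
    rw [sum_numOneInv_succ, if_neg (by omega), add_zero, ih (by omega), Nat.add_sub_add_right]

/-- The generating function of `d ↦ numOnce (d + k) k`. -/
noncomputable def onceSeries (k : ℕ) : PowerSeries ℤ :=
  X * catSeries ^ 3 * (catSeries ^ (k + 1) - X * catSeries ^ (k + 1) - 1)

theorem onceSeries_succ (k : ℕ) : onceSeries (k + 1) =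
    onceSeries k + X * onceSeries (k + 2) + (catSeries - X * catSeries - 1) := by
  simp only [onceSeries]
  linear_combination
    (X * catSeries ^ (k + 4) * (1 - X) - (1 + X * catSeries)) * catSeries_eq

theorem onceSeries_zero : onceSeries 0 = X * onceSeries 1 := by
  simp only [onceSeries]
  linear_combination X * catSeries ^ 3 * (1 - X) * catSeries_eq

theorem sum_coeff_catSeries_sub (d : ℕ) :
    ∑ i ∈ range (d + 1), coeff i (catSeries - X * catSeries - 1) = (catalan d : ℤ) - 1 := by
  induction d with
  | zero => simp [constantCoeff_catSeries]
  | succ d ih =>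
    rw [sum_range_succ, ih]
    simp only [map_sub, coeff_succ_X_mul, coeff_catSeries, coeff_one, Nat.succ_ne_zero, if_false]
    ring

theorem numOnce_eq {n k : ℕ} (hk : k ≤ n) : (numOnce n k : ℤ) = coeff (n - k) (onceSeries k) := by
  induction n generalizing k with
  | zero =>
    obtain rfl : k = 0 := by omega
    simp [numOnce, num321_eq_sum, onceSeries]
  | succ n ih =>
    have step : ∀ k ≤ n, (numOnce (n + 1) (k + 1) : ℤ) =
        coeff (n - k) (onceSeries (k + 1)) := by
      intro k hk
      rw [numOnce_succ_succ, ← sum_Ico_coeff_eq onceSeries_succ hk, sum_coeff_catSeries_sub,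
        ← sum_numOneInv_eq hk, sum_add_distrib, sum_eq_sum_Ico_succ_bot (a := k) (by omega)]
      push_cast
      rw [ih hk, add_assoc]
      congr 2
      refine sum_congr rfl fun v hv => ih ?_
      rw [mem_Ico] at hv
      omega
    cases k with
    | zero =>
      rw [← numOnce_one, step 0 (by omega), onceSeries_zero]
      simp [coeff_succ_X_mul]
    | succ k =>
      rw [step k (by omega), Nat.add_sub_add_right]

theorem X_mul_onceSeries_zero : X * onceSeries 0 = (catSeries - X * catSeries - 1) ^ 2 := by
  simp only [onceSeries]
  linear_combination -(catSeries - X * catSeries - 1) * (1 + X * catSeries) * catSeries_eq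

theorem coeff_catSeries_sub_sq (n : ℕ) :
    coeff (n + 1) ((catSeries - X * catSeries - 1) ^ 2) =
      ∑ b ∈ Icc 2 (n - 1), ((catalan b : ℤ) - catalan (b - 1)) *
        ((catalan (n - b + 1) : ℤ) - catalan (n - b)) := by
  have hsucc : ∀ m, coeff (m + 1) (catSeries - X * catSeries - 1) =
      (catalan (m + 1) : ℤ) - catalan m := by
    intro m
    simp [coeff_succ_X_mul, coeff_catSeries, coeff_one]
  have hzero : coeff 0 (catSeries - X * catSeries - 1) = 0 := by
    simp [constantCoeff_catSeries]
  have hone : coeff 1 (catSeries - X * catSeries - 1) = 0 := by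
    simpa using hsucc 0
  rw [pow_two, coeff_mul, Nat.sum_antidiagonal_eq_sum_range_succ_mk]
  have hsub : Icc 2 (n - 1) ⊆ range (n + 1).succ := by
    intro b hb
    rw [mem_Icc] at hb
    rw [mem_range]
    omega
  rw [← sum_subset hsub]
  · refine sum_congr rfl fun b hb => ?_
    rw [mem_Icc] at hb
    rw [show n + 1 - b = n - b + 1 by omega, hsucc]
    obtain ⟨b, rfl⟩ : ∃ c, b = c + 1 := ⟨b - 1, by omega⟩
    rw [hsucc, Nat.add_sub_cancel]
  · intro b hb hb'
    rw [mem_range] at hb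
    rw [mem_Icc] at hb'
    have : b = 0 ∨ b = 1 ∨ n + 1 - b = 0 ∨ n + 1 - b = 1 := by omega
    rcases this with h | h | h | h <;> simp only [h, hzero, hone, zero_mul, mul_zero]

end Series

theorem count_exactly_one_eq_sum (n : ℕ) (hn : 1 ≤ n) :
    (Nat.card {π : Equiv.Perm (Fin n) // ExactlyOne321 π} : ℤ) =
      ∑ b ∈ Finset.Icc 2 (n - 1),
        ((catalan b : ℤ) - catalan (b - 1)) *
          ((catalan (n - b + 1) : ℤ) - catalan (n - b)) := by
  have h : Nat.card {π : Equiv.Perm (Fin n) // ExactlyOne321 π} = numOnce n 0 := by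
    simp only [exactlyOne321_iff, Nat.card_eq_fintype_card, Fintype.card_subtype, numOnce,
      invBelow_zero, and_true]
  rw [h, numOnce_eq (Nat.zero_le n), Nat.sub_zero, ← coeff_catSeries_sub_sq,
    ← X_mul_onceSeries_zero, PowerSeries.coeff_succ_X_mul]
end

section
/- For every integer n ≥ 2, the sum over b from 2 to n−1 of (C_b − C_{b−1})·(C_{n−b+1} − C_{n−b}) equals C_{n+2} − 4·C_{n+1} + 3·C_n, where C_m denotes the m-th Catalan number. -/
theorem catalan_succ_eq_sum_range_int (n : ℕ) :
    (catalan (n + 1) : ℤ) =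
      ∑ i ∈ Finset.range (n + 1), (catalan i : ℤ) * catalan (n - i) := by
  rw [catalan_succ, ← Fin.sum_univ_eq_sum_range fun i ↦ (catalan i : ℤ) * catalan (n - i)]
  push_cast
  rfl

theorem sum_range_catalan_diff_prod (m : ℕ) :
    (∑ i ∈ Finset.range (m + 1),
        ((catalan (i + 1) : ℤ) - catalan i) *
          ((catalan (m - i + 1) : ℤ) - catalan (m - i))) =
      (catalan (m + 3) : ℤ) - 4 * catalan (m + 2) + 3 * catalan (m + 1) := by
  have shift : ∀ i ∈ Finset.range (m + 1), m + 1 - i = m - i + 1 := fun i hi ↦ by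
    have := Finset.mem_range.1 hi
    omega
  have h₀ := catalan_succ_eq_sum_range_int m
  have h_left := catalan_succ_eq_sum_range_int (m + 1)
  have h_right := h_left
  have h_both := catalan_succ_eq_sum_range_int (m + 2)
  rw [Finset.sum_range_succ'] at h_left
  rw [Finset.sum_range_succ,
    Finset.sum_congr rfl fun i hi ↦ by rw [shift i hi]] at h_right
  rw [Finset.sum_range_succ', Finset.sum_range_succ] at h_both
  simp only [Nat.reduceSubDiff, Nat.add_sub_add_right, Nat.sub_self, Nat.sub_zero, catalan_zero,
    Nat.cast_one, one_mul, mul_one, add_assoc, Nat.reduceAdd] at h_left h_right h_both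
  rw [Finset.sum_congr rfl fun i hi ↦ by rw [shift i hi]] at h_both
  simp only [sub_mul, mul_sub, Finset.sum_sub_distrib]
  linarith

theorem sum_catalan_diff_prod (n : ℕ) (hn : 2 ≤ n) :
    (∑ b ∈ Finset.Icc 2 (n - 1),
        ((catalan b : ℤ) - catalan (b - 1)) *
          ((catalan (n - b + 1) : ℤ) - catalan (n - b))) =
      (catalan (n + 2) : ℤ) - 4 * catalan (n + 1) + 3 * catalan n := by
  obtain ⟨k, rfl⟩ := Nat.exists_eq_add_of_le' hn
  rw [← sum_range_catalan_diff_prod (k + 1), Finset.sum_range_succ, Finset.sum_range_succ',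
    ← Finset.Ico_add_one_right_eq_Icc, Finset.sum_Ico_eq_sum_range]
  simp only [Nat.sub_self, zero_add, catalan_zero, catalan_one, sub_self, zero_mul, mul_zero,
    add_zero]
  refine Finset.sum_congr (by congr 1) fun i _ ↦ ?_
  rw [show 2 + i = i + 1 + 1 by omega, show k + 2 - (i + 1 + 1) = k + 1 - (i + 1) by omega,
    Nat.add_sub_cancel]
end

section
/- For every integer n ≥ 1, C_{n+2} − 4·C_{n+1} + 3·C_n = (3/n)·C(2n, n+3), where C_m denotes the m-th Catalan number and C(2n, n+3) the binomial coefficient '2n choose n+3'. -/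
/-- The recurrence between consecutive Catalan numbers. -/
theorem add_two_mul_catalan_succ (n : ℕ) :
    (n + 2) * catalan (n + 1) = 2 * (2 * n + 1) * catalan n := by
  apply Nat.eq_of_mul_eq_mul_left n.succ_pos
  have h := Nat.succ_mul_centralBinom_succ n
  rw [← succ_mul_catalan_eq_centralBinom, ← succ_mul_catalan_eq_centralBinom] at h
  simp only [Nat.succ_eq_add_one]
  linarith

/-- `Nat.choose_succ_right_eq` over a commutative ring, without truncated subtraction. -/
theorem cast_choose_succ_mul_succ {R : Type*} [CommRing R] (n k : ℕ) :
    (n.choose (k + 1) : R) * (k + 1) = n.choose k * (n - k) := by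
  rcases le_or_gt k n with h | h
  · rw [← Nat.cast_sub h]
    exact_mod_cast congrArg (Nat.cast (R := R)) (Nat.choose_succ_right_eq n k)
  · simp [Nat.choose_eq_zero_of_lt h, Nat.choose_eq_zero_of_lt (h.trans k.lt_succ_self)]

theorem catalan_comb_eq_noonan (n : ℕ) (hn : 1 ≤ n) :
    (catalan (n + 2) : ℚ) - 4 * catalan (n + 1) + 3 * catalan n =
      3 / n * Nat.choose (2 * n) (n + 3) := by
  have hn0 : (n : ℚ) ≠ 0 := by positivity
  have c₀ : ((n : ℚ) + 1) * catalan n = (2 * n).choose n := by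
    rw [← Nat.centralBinom_eq_two_mul_choose]
    exact_mod_cast succ_mul_catalan_eq_centralBinom n
  have c₁ : (catalan (n + 1) : ℚ) = 2 * (2 * n + 1) * catalan n / (n + 2) := by
    rw [eq_div_iff (by positivity), mul_comm]
    exact_mod_cast add_two_mul_catalan_succ n
  have c₂ : (catalan (n + 2) : ℚ) = 2 * (2 * n + 3) * catalan (n + 1) / (n + 3) := by
    rw [eq_div_iff (by positivity)]
    have h : ((n + 1 + 2 : ℕ) : ℚ) * catalan (n + 2) =
        2 * (2 * (n + 1 : ℕ) + 1) * catalan (n + 1) := by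
      exact_mod_cast add_two_mul_catalan_succ (n + 1)
    push_cast at h
    linarith
  have b₁ := cast_choose_succ_mul_succ (R := ℚ) (2 * n) n
  have b₂ := cast_choose_succ_mul_succ (R := ℚ) (2 * n) (n + 1)
  have b₃ := cast_choose_succ_mul_succ (R := ℚ) (2 * n) (n + 2)
  push_cast at b₁ b₂ b₃
  rw [← eq_div_iff (by positivity)] at b₁ b₂ b₃
  rw [b₃, b₂, b₁, c₂, c₁, ← c₀]
  field_simp
  ring
end

section
/- Let π be a permutation of {1, …, n} containing the pattern 321 exactly once, with unique occurrence at positions i < j < k, and write a = π(k), b = π(j), c = π(i) (so a < b < c). Then every entry of π at a position before j, other than the entry c at position i, is smaller than b; and every entry of π at a position after j, other than the entry a at position k, is larger than b. -/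
/-- If `π` contains 321 exactly once, at positions `i < j < k` (with values
`c = π i > b = π j > a = π k`), then every entry before position `j` other than the `c`
at position `i` is smaller than `b = π j`, and every entry after position `j` other than
the `a` at position `k` is larger than `b = π j`. -/
theorem entries_around_middle (n : ℕ) (π : Equiv.Perm (Fin n)) (i j k : Fin n)
    (hone : ExactlyOne321 π) (hocc : Occ321 π (i, j, k)) :
    (∀ l : Fin n, l < j → l ≠ i → π l < π j) ∧
      (∀ l : Fin n, j < l → l ≠ k → π j < π l) := by
  obtain ⟨hij, hjk, hji, hkj⟩ := hocc
  refine ⟨fun l hlj hli => ?_, fun l hjl hlk => ?_⟩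
  · by_contra hlt
    have hjl : π j < π l := lt_of_le_of_ne (not_lt.mp hlt) (π.injective.ne hlj.ne')
    exact hli (congrArg Prod.fst
      (hone.unique (y₁ := (l, j, k)) (y₂ := (i, j, k))
        ⟨hlj, hjk, hjl, hkj⟩ ⟨hij, hjk, hji, hkj⟩))
  · by_contra hlt
    have hlj : π l < π j := lt_of_le_of_ne (not_lt.mp hlt) (π.injective.ne hjl.ne')
    exact hlk (congrArg (fun t => t.2.2)
      (hone.unique (y₁ := (i, j, l)) (y₂ := (i, j, k))
        ⟨hij, hjl, hji, hlj⟩ ⟨hij, hjk, hji, hkj⟩))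
end
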